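/- arXiv:2409.19202 — 3 statements merged into one kernel-verified Lean document; each statement's English description precedes it below -/
import Mathlib

section
/- Let n, m ≥ 1 and D > 0. Let k_1,…,k_{n-1} > 2, k_n > 1, c_1,…,c_{m-1} > 2, and c_m > 1 be real constants. Let W : [-D,∞) → ℝ be m times continuously differentiable, and let z : [0,∞) → ℝⁿ and r : [0,∞) → ℝᵐ be differentiable and satisfy: ż_i(t) = -k_i z_i(t) + z_{i+1}(t) for i = 1,…,n-1; ż_n(t) = -k_n z_n(t) + W(t - D); ṙ_j(t) = -c_j r_j(t) + r_{j+1}(t) for j = 1,…,m-1; ṙ_m(t) = -c_m r_m(t); and W(t) = r_1(t) for all t ≥ 0. Define Ω(t) := Σ_{i=1}^{n} z_i(t)² + Σ_{j=1}^{m} r_j(t)² + Σ_{i=0}^{m} ∫_0^1 D^{2i} (W^{(i)}(t + D(x-1)))² dx. Then there exist positive constants Υ and σ, depending only on n, m, D, and the constants k_1,…,k_n, c_1,…,c_m, such that Ω(t) ≤ Υ Ω(0) e^{-σ t} for all t ≥ 0. -/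
open Set Finset Real

/-- The dissipation inequality of a scalar cascade `x_j' = -κ_j x_j + x_{j+1}` whose last
component is driven by `u`. -/
lemma cascade_dissipation (M : ℕ) (κ x : ℕ → ℝ) (u ρ : ℝ) (hκ : ∀ j < M, 2 < κ j)
    (hρ : ρ ≤ 1) (hρM : ρ ≤ 2 * κ M - 2) :
    (∑ j ∈ range M, 2 * x j * (-(κ j) * x j + x (j + 1))) + 2 * x M * (-(κ M) * x M + u)
      ≤ -ρ * (∑ j ∈ range (M + 1), x j ^ 2) + u ^ 2 := by
  have hterm : ∑ j ∈ range M, 2 * x j * (-(κ j) * x j + x (j + 1))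
      ≤ ∑ j ∈ range M, (-(ρ + 1) * x j ^ 2 + x (j + 1) ^ 2) := by
    refine Finset.sum_le_sum fun j hj => ?_
    have hj' := hκ j (Finset.mem_range.mp hj)
    nlinarith [sq_nonneg (x j - x (j + 1)), mul_nonneg (by linarith : 0 ≤ 2 * κ j - 2 - ρ)
      (sq_nonneg (x j))]
  have hshift : ∑ j ∈ range M, x (j + 1) ^ 2 ≤ ∑ j ∈ range (M + 1), x j ^ 2 := by
    rw [Finset.sum_range_succ']
    nlinarith [sq_nonneg (x 0)]
  rw [Finset.sum_add_distrib, ← Finset.mul_sum] at hterm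
  rw [Finset.sum_range_succ] at hshift ⊢
  nlinarith [sq_nonneg (x M - u), mul_nonneg (by linarith : 0 ≤ 2 * κ M - 2 - ρ)
    (sq_nonneg (x M))]

/-- Exponentially weighted energy estimate for a driven cascade. -/
lemma cascade_energy_le (M : ℕ) (κ : ℕ → ℝ) (ρ : ℝ) (hκ : ∀ j < M, 2 < κ j)
    (hρ : ρ ≤ 1) (hρM : ρ ≤ 2 * κ M - 2) (x : ℕ → ℝ → ℝ) (u : ℝ → ℝ) (hu : Continuous u)
    (hx : ∀ j < M, ∀ t ∈ Ici (0 : ℝ),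
      HasDerivWithinAt (x j) (-(κ j) * x j t + x (j + 1) t) (Ici 0) t)
    (hxM : ∀ t ∈ Ici (0 : ℝ), HasDerivWithinAt (x M) (-(κ M) * x M t + u t) (Ici 0) t)
    {t : ℝ} (ht : 0 ≤ t) :
    exp (ρ * t) * ∑ j ∈ range (M + 1), x j t ^ 2
      ≤ (∑ j ∈ range (M + 1), x j 0 ^ 2) + ∫ s in (0 : ℝ)..t, exp (ρ * s) * u s ^ 2 := by
  have hcu : Continuous fun s => exp (ρ * s) * u s ^ 2 := by fun_prop
  have hderiv : ∀ s ∈ Ici (0 : ℝ), HasDerivWithinAt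
      (fun s => exp (ρ * s) * (∑ j ∈ range (M + 1), x j s ^ 2)
        - ∫ v in (0 : ℝ)..s, exp (ρ * v) * u v ^ 2)
      (exp (ρ * s) * ρ * (∑ j ∈ range (M + 1), x j s ^ 2) + exp (ρ * s) *
        ((∑ j ∈ range M, 2 * x j s * (-(κ j) * x j s + x (j + 1) s))
          + 2 * x M s * (-(κ M) * x M s + u s)) - exp (ρ * s) * u s ^ 2) (Ici 0) s := by
    intro s hs
    have hexp : HasDerivAt (fun s : ℝ => exp (ρ * s)) (exp (ρ * s) * ρ) s := by
      simpa using ((hasDerivAt_id s).const_mul ρ).exp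
    have hsum : HasDerivWithinAt (fun s => ∑ j ∈ range (M + 1), x j s ^ 2)
        ((∑ j ∈ range M, 2 * x j s * (-(κ j) * x j s + x (j + 1) s))
          + 2 * x M s * (-(κ M) * x M s + u s)) (Ici 0) s := by
      simp only [Finset.sum_range_succ]
      refine HasDerivWithinAt.fun_add (HasDerivWithinAt.fun_sum fun j hj => ?_) ?_
      · simpa using (hx j (Finset.mem_range.mp hj) s hs).fun_pow 2
      · simpa using (hxM s hs).fun_pow 2
    exact (hexp.hasDerivWithinAt.fun_mul hsum).fun_sub
      (hcu.integral_hasStrictDerivAt 0 s).hasDerivAt.hasDerivWithinAt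
  have hanti := antitoneOn_of_hasDerivWithinAt_nonpos (convex_Ici (0 : ℝ))
    (fun s hs => (hderiv s hs).continuousWithinAt)
    (fun s hs => (hderiv s (interior_subset hs)).mono interior_subset)
    (fun s _ => by
      have := mul_le_mul_of_nonneg_left
        (cascade_dissipation M κ (fun j => x j s) (u s) ρ hκ hρ hρM) (exp_pos (ρ * s)).le
      linarith)
  have := hanti (mem_Ici.mpr le_rfl) (mem_Ici.mpr ht) ht
  simp only [mul_zero, exp_zero, one_mul, intervalIntegral.integral_same, sub_zero] at this
  linarith

/-- If `g` decays at rate `2σ` on `(0, ∞)`, its integral with weight `exp (σ s)` is bounded. -/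
lemma exp_weighted_integral_le {g : ℝ → ℝ} (hg : Continuous g) (hg0 : ∀ s, 0 ≤ g s)
    {D σ K : ℝ} (hD : 0 ≤ D) (hσ : 0 < σ) (hK : 0 ≤ K)
    (hdecay : ∀ s, 0 < s → g s ≤ K * exp (-(2 * σ * s))) {t : ℝ} (ht : 0 ≤ t) :
    ∫ s in (-D)..t, exp (σ * s) * g s ≤ (∫ s in (-D)..0, g s) + K / σ := by
  have hcg : Continuous fun s => exp (σ * s) * g s := by fun_prop
  have hderiv : ∀ s : ℝ, HasDerivAt
      (fun s => (∫ v in (-D)..s, exp (σ * v) * g v) + K / σ * exp (-(σ * s)))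
      (exp (σ * s) * g s - K * exp (-(σ * s))) s := by
    intro s
    have hexp : HasDerivAt (fun s : ℝ => exp (-(σ * s))) (exp (-(σ * s)) * -σ) s := by
      simpa using ((hasDerivAt_id s).const_mul σ).fun_neg.exp
    refine ((hcg.integral_hasStrictDerivAt (-D) s).hasDerivAt.fun_add
      (hexp.const_mul (K / σ))).congr_deriv ?_
    field_simp
    ring
  have hanti := antitoneOn_of_hasDerivWithinAt_nonpos (convex_Ici (0 : ℝ))
    (fun s _ => (hderiv s).continuousAt.continuousWithinAt)
    (fun s _ => (hderiv s).hasDerivWithinAt)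
    (fun s hs => by
      rw [interior_Ici] at hs
      have h1 := mul_le_mul_of_nonneg_left (hdecay s hs) (exp_pos (σ * s)).le
      have h2 : exp (σ * s) * (K * exp (-(2 * σ * s))) = K * exp (-(σ * s)) := by
        rw [mul_left_comm, ← exp_add]
        ring_nf
      linarith)
  have h := hanti (mem_Ici.mpr le_rfl) (mem_Ici.mpr ht) ht
  have h0 : ∫ s in (-D)..0, exp (σ * s) * g s ≤ ∫ s in (-D)..0, g s := by
    refine intervalIntegral.integral_mono_on (by linarith) (hcg.intervalIntegrable _ _)
      (hg.intervalIntegrable _ _) fun s hs => ?_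
    exact mul_le_of_le_one_left (hg0 s)
      (exp_le_one_iff.mpr (mul_nonpos_of_nonneg_of_nonpos hσ.le hs.2))
  have hpos : 0 ≤ K / σ * exp (-(σ * t)) := by positivity
  simp only [mul_zero, neg_zero, exp_zero, mul_one] at h
  linarith

/-- The integral over the sliding window `[t - D, t]` is controlled by the weighted integral over
`[-D, t]`. -/
lemma exp_mul_window_integral_le {g : ℝ → ℝ} (hg : Continuous g) (hg0 : ∀ s, 0 ≤ g s)
    {D σ : ℝ} (hD : 0 ≤ D) (hσ : 0 < σ) {t : ℝ} (ht : 0 ≤ t) :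
    exp (σ * t) * (∫ s in (t - D)..t, g s)
      ≤ exp (σ * D) * ∫ s in (-D)..t, exp (σ * s) * g s := by
  have hcg : Continuous fun s => exp (σ * s) * g s := by fun_prop
  calc exp (σ * t) * (∫ s in (t - D)..t, g s)
      = ∫ s in (t - D)..t, exp (σ * t) * g s := by rw [intervalIntegral.integral_const_mul]
    _ ≤ ∫ s in (t - D)..t, exp (σ * D) * (exp (σ * s) * g s) := by
        refine intervalIntegral.integral_mono_on (by linarith)
          ((hg.const_mul _).intervalIntegrable _ _)
          ((hcg.const_mul _).intervalIntegrable _ _) fun s hs => ?_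
        rw [← mul_assoc, ← exp_add]
        refine mul_le_mul_of_nonneg_right (exp_le_exp.mpr ?_) (hg0 s)
        nlinarith [hs.1]
    _ = exp (σ * D) * ∫ s in (t - D)..t, exp (σ * s) * g s := by
        rw [intervalIntegral.integral_const_mul]
    _ ≤ exp (σ * D) * ∫ s in (-D)..t, exp (σ * s) * g s := by
        refine mul_le_mul_of_nonneg_left ?_ (exp_pos _).le
        exact intervalIntegral.integral_mono_interval (by linarith) (by linarith) le_rfl
          (Filter.Eventually.of_forall fun s => mul_nonneg (exp_pos _).le (hg0 s))
          (hcg.intervalIntegrable _ _)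

/-- The delayed weighted integral is controlled by the weighted integral over `[-D, t]`. -/
lemma exp_weighted_delayed_integral_le {g : ℝ → ℝ} (hg : Continuous g) (hg0 : ∀ s, 0 ≤ g s)
    {D : ℝ} (σ : ℝ) (hD : 0 ≤ D) {t : ℝ} (ht : 0 ≤ t) :
    ∫ s in (0 : ℝ)..t, exp (σ * s) * g (s - D)
      ≤ exp (σ * D) * ∫ s in (-D)..t, exp (σ * s) * g s := by
  have hcg : Continuous fun s => exp (σ * s) * g s := by fun_prop
  have hshift : ∫ s in (0 : ℝ)..t, exp (σ * s) * g (s - D)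
      = exp (σ * D) * ∫ s in (-D)..(t - D), exp (σ * s) * g s := by
    have h := intervalIntegral.integral_comp_sub_right (a := 0) (b := t)
      (fun s => exp (σ * s) * g s) D
    rw [zero_sub] at h
    rw [← h, ← intervalIntegral.integral_const_mul]
    refine intervalIntegral.integral_congr fun s _ => ?_
    rw [← mul_assoc, ← exp_add]
    ring_nf
  rw [hshift]
  refine mul_le_mul_of_nonneg_left ?_ (exp_pos _).le
  exact intervalIntegral.integral_mono_interval le_rfl (by linarith) (by linarith)
    (Filter.Eventually.of_forall fun s => mul_nonneg (exp_pos _).le (hg0 s))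
    (hcg.intervalIntegrable _ _)

/-- All derivatives of the head of an undriven cascade are linear combinations of its components,
with coefficients depending only on the gains. -/
lemma exists_iteratedDerivWithin_eq_sum (M : ℕ) (c : ℕ → ℝ) (D : ℝ) (hD : 0 < D) (i : ℕ) :
    ∃ a : ℕ → ℝ, ∀ (W : ℝ → ℝ) (r : ℕ → ℝ → ℝ),
      (∀ j < M, ∀ t ∈ Ici (0 : ℝ),
        HasDerivWithinAt (r j) (-(c j) * r j t + r (j + 1) t) (Ici 0) t) →
      (∀ t ∈ Ici (0 : ℝ), HasDerivWithinAt (r M) (-(c M) * r M t) (Ici 0) t) →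
      (∀ t ∈ Ici (0 : ℝ), W t = r 0 t) →
      ∀ s, 0 < s → iteratedDerivWithin i W (Ici (-D)) s = ∑ j ∈ range (M + 1), a j * r j s := by
  induction i with
  | zero =>
    refine ⟨fun j => if j = 0 then 1 else 0, fun W r _ _ hW s hs => ?_⟩
    simp [hW s hs.le]
  | succ i ih =>
    obtain ⟨a, ha⟩ := ih
    refine ⟨fun j => -(c j) * a j + (if j = 0 then 0 else a (j - 1)),
      fun W r hr hrM hW s hs => ?_⟩
    have hev : iteratedDerivWithin i W (Ici (-D))
        =ᶠ[nhds s] fun v => ∑ j ∈ range (M + 1), a j * r j v := by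
      filter_upwards [Ioi_mem_nhds hs] with v hv using ha W r hr hrM hW v hv
    have hderiv : HasDerivAt (fun v => ∑ j ∈ range (M + 1), a j * r j v)
        ((∑ j ∈ range M, a j * (-(c j) * r j s + r (j + 1) s)) + a M * (-(c M) * r M s)) s := by
      simp only [Finset.sum_range_succ]
      refine HasDerivAt.fun_add (HasDerivAt.fun_sum fun j hj => ?_) ?_
      · exact ((hr j (Finset.mem_range.mp hj) s hs.le).hasDerivAt (Ici_mem_nhds hs)).const_mul _
      · exact ((hrM s hs.le).hasDerivAt (Ici_mem_nhds hs)).const_mul _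
    rw [iteratedDerivWithin_succ, derivWithin_of_mem_nhds (Ici_mem_nhds (by linarith)),
      hev.deriv_eq, hderiv.deriv]
    simp only [add_mul, Finset.sum_add_distrib, mul_add]
    rw [Finset.sum_range_succ,
      Finset.sum_range_succ' (fun j => (if j = 0 then 0 else a (j - 1)) * r j s)]
    simp only [Nat.add_eq_zero_iff, one_ne_zero, and_false, if_false, Nat.add_sub_cancel, if_true,
      zero_mul, add_zero]
    have : ∀ j, a j * (-(c j) * r j s) = -(c j) * a j * r j s := fun j => by ring
    simp only [this]
    ring

/-- The squared `i`-th derivative of the transport profile, extended constantly to the left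
of `-D`. -/
noncomputable def transportDensity (W : ℝ → ℝ) (D : ℝ) (i : ℕ) (s : ℝ) : ℝ :=
  iteratedDerivWithin i W (Ici (-D)) (max s (-D)) ^ 2

lemma transportDensity_nonneg (W : ℝ → ℝ) (D : ℝ) (i : ℕ) (s : ℝ) :
    0 ≤ transportDensity W D i s := sq_nonneg _

lemma continuous_transportDensity {W : ℝ → ℝ} {D : ℝ} {m i : ℕ}
    (hW : ContDiffOn ℝ (m : ℕ∞) W (Ici (-D))) (hi : i ≤ m) :
    Continuous (transportDensity W D i) := by
  have h := hW.continuousOn_iteratedDerivWithin (m := i) (by exact_mod_cast hi)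
    (uniqueDiffOn_Ici _)
  exact (h.comp_continuous (by fun_prop) fun s => le_max_right s (-D)).pow 2

/-- Change of variables from the spatial variable to the time window `[t - D, t]`. -/
lemma integral_transport_eq (W : ℝ → ℝ) {D : ℝ} (hD : 0 < D) (i : ℕ) {t : ℝ} (ht : 0 ≤ t) :
    ∫ x in (0 : ℝ)..1,
        D ^ (2 * i) * iteratedDerivWithin i W (Ici (-D)) (t + D * (x - 1)) ^ 2
      = D ^ (2 * i) * D⁻¹ * ∫ s in (t - D)..t, transportDensity W D i s := by
  have h := intervalIntegral.integral_comp_add_mul (a := 0) (b := 1)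
    (transportDensity W D i) hD.ne' (t - D)
  rw [mul_zero, add_zero, mul_one, sub_add_cancel, smul_eq_mul] at h
  rw [intervalIntegral.integral_const_mul, mul_assoc, ← h]
  congr 1
  refine intervalIntegral.integral_congr fun x hx => ?_
  rw [Set.uIcc_of_le zero_le_one] at hx
  have hx0 : 0 ≤ D * x := mul_nonneg hD.le hx.1
  simp only [transportDensity]
  rw [max_eq_left (by linarith)]
  ring_nf

/-- Lemma 1: exponential stability of the target system.
The transport state is represented as `w(x,t) = W(t + D(x-1))` with `W : [-D,∞) → ℝ`
of class `C^m` extending the boundary signal `r 0` (0-based indices), and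
`Ω(t) = Σ z_i(t)² + Σ r_j(t)² + Σ_{i=0}^{m} ∫_0^1 D^{2i} (W^{(i)}(t+D(x-1)))² dx`.
The decay constants depend only on `n, m, D` and the gains. -/
theorem stmt_4 (n m : ℕ) (hn : 1 ≤ n) (hm : 1 ≤ m) (D : ℝ) (hD : 0 < D)
    (k c : ℕ → ℝ)
    (hk : ∀ i, i + 1 < n → 2 < k i) (hkn : 1 < k (n - 1))
    (hc : ∀ j, j + 1 < m → 2 < c j) (hcm : 1 < c (m - 1)) :
    ∃ Υ > (0:ℝ), ∃ σ > (0:ℝ),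
      ∀ (W : ℝ → ℝ) (z r : ℕ → ℝ → ℝ),
        ContDiffOn ℝ (m : ℕ∞) W (Ici (-D)) →
        (∀ i, i + 1 < n → ∀ t ∈ Ici (0:ℝ),
          HasDerivWithinAt (z i) (-(k i) * z i t + z (i + 1) t) (Ici 0) t) →
        (∀ t ∈ Ici (0:ℝ),
          HasDerivWithinAt (z (n - 1)) (-(k (n - 1)) * z (n - 1) t + W (t - D)) (Ici 0) t) →
        (∀ j, j + 1 < m → ∀ t ∈ Ici (0:ℝ),
          HasDerivWithinAt (r j) (-(c j) * r j t + r (j + 1) t) (Ici 0) t) →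
        (∀ t ∈ Ici (0:ℝ),
          HasDerivWithinAt (r (m - 1)) (-(c (m - 1)) * r (m - 1) t) (Ici 0) t) →
        (∀ t ∈ Ici (0:ℝ), W t = r 0 t) →
        ∀ t ∈ Ici (0:ℝ),
          ((∑ i ∈ range n, (z i t) ^ 2) + (∑ j ∈ range m, (r j t) ^ 2)
            + ∑ i ∈ range (m + 1), ∫ x in (0:ℝ)..1,
                D ^ (2 * i) * (iteratedDerivWithin i W (Ici (-D)) (t + D * (x - 1))) ^ 2)
          ≤ Υ * ((∑ i ∈ range n, (z i 0) ^ 2) + (∑ j ∈ range m, (r j 0) ^ 2)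
            + ∑ i ∈ range (m + 1), ∫ x in (0:ℝ)..1,
                D ^ (2 * i) * (iteratedDerivWithin i W (Ici (-D)) (D * (x - 1))) ^ 2)
            * exp (-σ * t) := by
  obtain ⟨N, rfl⟩ : ∃ N, n = N + 1 := ⟨n - 1, by omega⟩
  obtain ⟨M, rfl⟩ : ∃ M, m = M + 1 := ⟨m - 1, by omega⟩
  simp only [Nat.add_sub_cancel, Nat.add_lt_add_iff_right] at *
  choose a ha using exists_iteratedDerivWithin_eq_sum M c D hD
  obtain ⟨σ, hσ, hσ1, hσk, hσc⟩ : ∃ σ > (0 : ℝ), 2 * σ ≤ 1 ∧ 2 * σ ≤ 2 * k N - 2 ∧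
      2 * σ ≤ 2 * c M - 2 :=
    ⟨min (1 / 2) (min (k N - 1) (c M - 1)), by
        simp only [gt_iff_lt, lt_min_iff]; exact ⟨by norm_num, by linarith, by linarith⟩,
      by linarith [min_le_left (1 / 2) (min (k N - 1) (c M - 1))],
      by linarith [min_le_right (1 / 2) (min (k N - 1) (c M - 1)),
        min_le_left (k N - 1) (c M - 1)],
      by linarith [min_le_right (1 / 2) (min (k N - 1) (c M - 1)),
        min_le_right (k N - 1) (c M - 1)]⟩
  set C : ℕ → ℝ := fun i => ∑ j ∈ range (M + 1), a i j ^ 2 with hC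
  have hC0 : ∀ i, 0 ≤ C i := fun i => Finset.sum_nonneg fun j _ => sq_nonneg _
  set p : ℕ → ℝ := fun i => D ^ (2 * i) * D⁻¹ with hp
  have hp0 : ∀ i, 0 ≤ p i := fun i => by positivity
  set E := exp (σ * D) with hE
  have hE0 : 0 < E := exp_pos _
  set Q := ∑ i ∈ range (M + 1 + 1), p i * (C i / σ) with hQ
  have hQ0 : 0 ≤ Q :=
    Finset.sum_nonneg fun i _ => mul_nonneg (hp0 i) (div_nonneg (hC0 i) hσ.le)
  have hC00 : 0 ≤ C 0 / σ := div_nonneg (hC0 0) hσ.le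
  refine ⟨1 + E * (C 0 / σ) + E * Q + E * D + E, by positivity, σ, hσ, ?_⟩
  intro W z r hW hz hzN hr hrM hWr t ht
  have ht0 : 0 ≤ t := ht
  set g := transportDensity W D with hg
  have hgc : ∀ i < M + 1 + 1, Continuous (g i) := fun i hi =>
    continuous_transportDensity hW (Nat.lt_succ_iff.mp hi)
  have hg0 : ∀ i s, 0 ≤ g i s := transportDensity_nonneg W D
  set Z := fun s => ∑ i ∈ range (N + 1), z i s ^ 2 with hZ
  set R := fun s => ∑ j ∈ range (M + 1), r j s ^ 2 with hR
  have hZ0 : 0 ≤ Z 0 := Finset.sum_nonneg fun j _ => sq_nonneg _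
  have hR0 : 0 ≤ R 0 := Finset.sum_nonneg fun j _ => sq_nonneg _
  have hRdecay : ∀ s, 0 ≤ s → R s ≤ R 0 * exp (-(2 * σ * s)) := by
    intro s hs
    have h := cascade_energy_le M c (2 * σ) hc hσ1 hσc r (fun _ => 0) continuous_const hr
      (by simpa using hrM) hs
    simp only [ne_eq, OfNat.ofNat_ne_zero, not_false_eq_true, zero_pow, mul_zero,
      intervalIntegral.integral_zero, add_zero] at h
    rw [exp_neg, ← div_eq_mul_inv, le_div_iff₀ (exp_pos _), mul_comm]
    exact h
  have hgdecay : ∀ i s, 0 < s → g i s ≤ C i * R 0 * exp (-(2 * σ * s)) := by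
    intro i s hs
    calc g i s = (∑ j ∈ range (M + 1), a i j * r j s) ^ 2 := by
          rw [hg, transportDensity, max_eq_left (by linarith), ha i W r hr hrM hWr s hs]
      _ ≤ C i * R s := Finset.sum_mul_sq_le_sq_mul_sq _ _ _
      _ ≤ C i * (R 0 * exp (-(2 * σ * s))) :=
          mul_le_mul_of_nonneg_left (hRdecay s hs.le) (hC0 i)
      _ = C i * R 0 * exp (-(2 * σ * s)) := by ring
  set I := fun i => ∫ s in (-D)..0, g i s with hI
  have hI0 : ∀ i, 0 ≤ I i := fun i =>
    intervalIntegral.integral_nonneg (by linarith) fun s _ => hg0 i s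
  have hJ : ∀ i < M + 1 + 1,
      ∫ s in (-D)..t, exp (σ * s) * g i s ≤ I i + C i / σ * R 0 := by
    intro i hi
    have h := exp_weighted_integral_le (hgc i hi) (hg0 i) hD.le hσ (mul_nonneg (hC0 i) hR0)
      (hgdecay i) ht0
    rwa [mul_div_right_comm] at h
  have hrewrite : ∀ v, 0 ≤ v → ∑ i ∈ range (M + 1 + 1), (∫ x in (0 : ℝ)..1,
      D ^ (2 * i) * iteratedDerivWithin i W (Ici (-D)) (v + D * (x - 1)) ^ 2)
      = ∑ i ∈ range (M + 1 + 1), p i * ∫ s in (v - D)..v, g i s := fun v hv =>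
    Finset.sum_congr rfl fun i _ => integral_transport_eq W hD i hv
  have hinit := hrewrite 0 le_rfl
  simp only [zero_add, zero_sub] at hinit
  rw [hrewrite t ht0, hinit]
  set S := ∑ i ∈ range (M + 1 + 1), p i * I i with hS
  have hS0 : 0 ≤ S := Finset.sum_nonneg fun i _ => mul_nonneg (hp0 i) (hI0 i)
  have hI0S : I 0 ≤ D * S := by
    have h : p 0 * I 0 ≤ S := Finset.single_le_sum (f := fun i => p i * I i)
      (fun i _ => mul_nonneg (hp0 i) (hI0 i)) (Finset.mem_range.mpr (Nat.succ_pos _))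
    have h' := mul_le_mul_of_nonneg_left h hD.le
    simpa [hp, hD.ne'] using h'
  have hZt : exp (σ * t) * Z t ≤ Z 0 + E * (I 0 + C 0 / σ * R 0) := by
    have hcont : Continuous fun s => W (max (s - D) (-D)) :=
      hW.continuousOn.comp_continuous (by fun_prop) fun s => mem_Ici.mpr (le_max_right _ _)
    have h := cascade_energy_le N k σ hk (by linarith) (by linarith) z
      (fun s => W (max (s - D) (-D))) hcont hz
      (fun s hs => by
        have hs' : (0 : ℝ) ≤ s := hs
        simpa only [max_eq_left (by linarith : -D ≤ s - D)] using hzN s hs) ht0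
    have h' := exp_weighted_delayed_integral_le (hgc 0 (Nat.succ_pos _)) (hg0 0) σ hD.le ht0
    simp only [hg, transportDensity, iteratedDerivWithin_zero] at h'
    have h'' := mul_le_mul_of_nonneg_left (hJ 0 (Nat.succ_pos _)) hE0.le
    simp only [hg, transportDensity, iteratedDerivWithin_zero] at h''
    linarith
  have hRt : exp (σ * t) * R t ≤ R 0 := by
    have h := mul_le_mul_of_nonneg_left (hRdecay t ht0) (exp_pos (σ * t)).le
    have h2 : exp (σ * t) * (R 0 * exp (-(2 * σ * t))) = R 0 * exp (-(σ * t)) := by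
      rw [mul_left_comm, ← exp_add]
      ring_nf
    have h3 : exp (-(σ * t)) ≤ 1 := exp_le_one_iff.mpr (by nlinarith)
    nlinarith
  have hIt : exp (σ * t) * ∑ i ∈ range (M + 1 + 1), p i * (∫ s in (t - D)..t, g i s)
      ≤ E * S + E * Q * R 0 := by
    calc exp (σ * t) * ∑ i ∈ range (M + 1 + 1), p i * (∫ s in (t - D)..t, g i s)
        = ∑ i ∈ range (M + 1 + 1), p i * (exp (σ * t) * ∫ s in (t - D)..t, g i s) := by
          rw [Finset.mul_sum]
          exact Finset.sum_congr rfl fun i _ => by ring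
      _ ≤ ∑ i ∈ range (M + 1 + 1), p i * (E * (I i + C i / σ * R 0)) := by
          refine Finset.sum_le_sum fun i hi => mul_le_mul_of_nonneg_left ?_ (hp0 i)
          have hi' := Finset.mem_range.mp hi
          exact (exp_mul_window_integral_le (hgc i hi') (hg0 i) hD.le hσ ht0).trans
            (mul_le_mul_of_nonneg_left (hJ i hi') hE0.le)
      _ = E * S + E * Q * R 0 := by
          generalize R 0 = R₀
          rw [hS, hQ, Finset.mul_sum, Finset.mul_sum, Finset.sum_mul, ← Finset.sum_add_distrib]
          exact Finset.sum_congr rfl fun i _ => by ring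
  rw [neg_mul, exp_neg, ← div_eq_mul_inv, le_div_iff₀ (exp_pos _)]
  have hEI := mul_le_mul_of_nonneg_left hI0S hE0.le
  have hΥZ : 0 ≤ (E * (C 0 / σ) + E * Q + E * D + E) * Z 0 := by positivity
  have hΥR : 0 ≤ (E * D + E) * R 0 := by positivity
  have hΥS : 0 ≤ (1 + E * (C 0 / σ) + E * Q) * S := by positivity
  linarith
end

section
/- Let n, m ≥ 1 and D > 0. Let k_1,…,k_{n-1} > 2, k_n > 1, c_1,…,c_{m-1} > 2, and c_m > 1 be real constants. Let W : [-D,∞) → ℝ be m times continuously differentiable, and let z : [0,∞) → ℝⁿ and r : [0,∞) → ℝᵐ be differentiable and satisfy: ż_i(t) = -k_i z_i(t) + z_{i+1}(t) for i = 1,…,n-1; ż_n(t) = -k_n z_n(t) + W(t - D); ṙ_j(t) = -c_j r_j(t) + r_{j+1}(t) for j = 1,…,m-1; ṙ_m(t) = -c_m r_m(t); and W(t) = r_1(t) for all t ≥ 0. Write Z(t) = (z_1(t),…,z_n(t)). Then Z is (m+1) times continuously differentiable on (D,∞), and there exist positive constants C and σ, with σ depending only on n, m, D, and the constants k_i, c_j,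 and C depending additionally on the initial data, such that for all t ≥ 0: sup_{x ∈ [0,1]} |Z(t + Dx)|² ≤ C e^{-σ t}, and |(d/dt)^i [Z(t + D)]|² ≤ C e^{-σ t} for every i = 0,…,m. -/
open Set Finset Real

/-- One-sided comparison for `u' = -a u + v` with `v` bounded by a multiple of `exp (-t)`. -/
lemma le_mul_exp_neg_of_hasDerivWithinAt {a B : ℝ} (ha : 1 < a) (hB : 0 ≤ B) {u v : ℝ → ℝ}
    (hu : ∀ t ∈ Ici (0 : ℝ), HasDerivWithinAt u (-a * u t + v t) (Ici 0) t)
    (hv : ∀ t ∈ Ici (0 : ℝ), v t ≤ B * exp (-t)) {t : ℝ} (ht : 0 ≤ t) :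
    u t ≤ (|u 0| + B / (a - 1)) * exp (-t) := by
  have ha' : 0 < a - 1 := by linarith
  have hderiv : ∀ s ∈ Ici (0 : ℝ), HasDerivWithinAt
      (fun s => exp (a * s) * u s - B / (a - 1) * exp ((a - 1) * s))
      (exp (a * s) * (v s - B * exp (-s))) (Ici 0) s := by
    intro s hs
    have h₁ : HasDerivAt (fun s => exp (a * s)) (exp (a * s) * a) s := by
      simpa using ((hasDerivAt_id s).const_mul a).exp
    have h₂ : HasDerivAt (fun s => exp ((a - 1) * s)) (exp ((a - 1) * s) * (a - 1)) s := by
      simpa using ((hasDerivAt_id s).const_mul (a - 1)).exp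
    have hexp : exp ((a - 1) * s) = exp (a * s) * exp (-s) := by
      rw [← exp_add]; ring_nf
    refine ((h₁.hasDerivWithinAt.mul (hu s hs)).sub
      (h₂.hasDerivWithinAt.const_mul (B / (a - 1)))).congr_deriv ?_
    rw [hexp]
    field_simp
    ring
  have hanti : AntitoneOn
      (fun s => exp (a * s) * u s - B / (a - 1) * exp ((a - 1) * s)) (Ici (0 : ℝ)) := by
    refine antitoneOn_of_hasDerivWithinAt_nonpos (convex_Ici 0)
      (fun s hs => (hderiv s hs).continuousWithinAt)
      (fun s hs => (hderiv s (interior_subset hs)).mono interior_subset) fun s hs => ?_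
    exact mul_nonpos_of_nonneg_of_nonpos (exp_pos _).le
      (sub_nonpos.2 (hv s (interior_subset hs)))
  have hle := hanti self_mem_Ici (mem_Ici.2 ht) ht
  simp only [mul_zero, exp_zero, one_mul, mul_one] at hle
  have hq : 0 ≤ B / (a - 1) := by positivity
  have hexp : exp ((a - 1) * t) = exp (a * t) * exp (-t) := by
    rw [← exp_add]; ring_nf
  have hone : 1 ≤ exp (a * t) * exp (-t) := by
    rw [← hexp]; exact one_le_exp (by positivity)
  rw [hexp] at hle
  refine le_of_mul_le_mul_left ?_ (exp_pos (a * t))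
  nlinarith [le_abs_self (u 0), abs_nonneg (u 0),
    mul_le_mul_of_nonneg_left hone (abs_nonneg (u 0))]

lemma abs_le_mul_exp_neg_of_hasDerivWithinAt {a B : ℝ} (ha : 1 < a) (hB : 0 ≤ B)
    {u v : ℝ → ℝ}
    (hu : ∀ t ∈ Ici (0 : ℝ), HasDerivWithinAt u (-a * u t + v t) (Ici 0) t)
    (hv : ∀ t ∈ Ici (0 : ℝ), |v t| ≤ B * exp (-t)) {t : ℝ} (ht : 0 ≤ t) :
    |u t| ≤ (|u 0| + B / (a - 1)) * exp (-t) := by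
  refine abs_le'.2 ⟨le_mul_exp_neg_of_hasDerivWithinAt ha hB hu
    (fun s hs => (le_abs_self _).trans (hv s hs)) ht, ?_⟩
  have hneg : ∀ s ∈ Ici (0 : ℝ),
      HasDerivWithinAt (fun s => -u s) (-a * -u s + -v s) (Ici 0) s := fun s hs =>
    (hu s hs).fun_neg.congr_deriv (by ring)
  simpa using le_mul_exp_neg_of_hasDerivWithinAt ha hB hneg
    (fun s hs => (neg_le_abs _).trans (hv s hs)) ht

section Cascade

variable {a : ℕ → ℝ} {u : ℕ → ℝ → ℝ}

lemma cascade_abs_le_mul_exp_neg (ha : ∀ i, 1 < a i)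
    (hu : ∀ i, ∀ t ∈ Ici (0 : ℝ),
      HasDerivWithinAt (u i) (-a i * u i t + u (i + 1) t) (Ici 0) t)
    {N : ℕ} (hN : ∀ i, N ≤ i → u i = 0) (i : ℕ) :
    ∃ C, 0 ≤ C ∧ ∀ t ∈ Ici (0 : ℝ), |u i t| ≤ C * exp (-t) := by
  rcases le_total N i with h | h
  · exact ⟨0, le_rfl, fun t _ => by simp [hN i h]⟩
  induction h using Nat.decreasingInduction with
  | self => exact ⟨0, le_rfl, fun t _ => by simp [hN N le_rfl]⟩
  | of_succ i _ ih =>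
    obtain ⟨B, hB, hv⟩ := ih
    have ha' : 0 < a i - 1 := sub_pos.2 (ha i)
    exact ⟨|u i 0| + B / (a i - 1), by positivity, fun t ht =>
      abs_le_mul_exp_neg_of_hasDerivWithinAt (ha i) hB (hu i) hv ht⟩

lemma cascade_contDiffOn
    (hu : ∀ i, ∀ t ∈ Ici (0 : ℝ),
      HasDerivWithinAt (u i) (-a i * u i t + u (i + 1) t) (Ici 0) t) (p i : ℕ) :
    ContDiffOn ℝ p (u i) (Ici 0) := by
  induction p generalizing i with
  | zero => exact contDiffOn_zero.2 fun t ht => (hu i t ht).continuousWithinAt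
  | succ p ih =>
    push_cast
    rw [contDiffOn_succ_iff_derivWithin (uniqueDiffOn_Ici 0)]
    refine ⟨fun t ht => (hu i t ht).differentiableWithinAt, by simp, ?_⟩
    refine ((contDiffOn_const.mul (ih i)).add (ih (i + 1))).congr (f := fun t =>
      -a i * u i t + u (i + 1) t) fun t ht => ?_
    exact (hu i t ht).derivWithin (uniqueDiffOn_Ici 0 t ht)

lemma cascade_iteratedDerivWithin_succ
    (hu : ∀ i, ∀ t ∈ Ici (0 : ℝ),
      HasDerivWithinAt (u i) (-a i * u i t + u (i + 1) t) (Ici 0) t) (p i : ℕ)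
    {t : ℝ} (ht : t ∈ Ici (0 : ℝ)) :
    iteratedDerivWithin (p + 1) (u i) (Ici 0) t =
      -a i * iteratedDerivWithin p (u i) (Ici 0) t +
        iteratedDerivWithin p (u (i + 1)) (Ici 0) t := by
  have hs := uniqueDiffOn_Ici (0 : ℝ)
  have hderiv : EqOn (derivWithin (u i) (Ici 0))
      ((fun s => -a i * u i s) + u (i + 1)) (Ici 0) := fun s hs' =>
    (hu i s hs').derivWithin (hs s hs')
  have hsmooth := fun l => cascade_contDiffOn hu p l t ht
  rw [iteratedDerivWithin_succ', iteratedDerivWithin_congr hderiv ht,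
    iteratedDerivWithin_add ht hs (contDiffWithinAt_const.mul (hsmooth i)) (hsmooth (i + 1)),
    iteratedDerivWithin_const_mul ht hs _ (hsmooth i)]

lemma cascade_abs_iteratedDerivWithin_le_mul_exp_neg (ha : ∀ i, 1 < a i)
    (hu : ∀ i, ∀ t ∈ Ici (0 : ℝ),
      HasDerivWithinAt (u i) (-a i * u i t + u (i + 1) t) (Ici 0) t)
    {N : ℕ} (hN : ∀ i, N ≤ i → u i = 0) (p i : ℕ) :
    ∃ C, ∀ t ∈ Ici (0 : ℝ), |iteratedDerivWithin p (u i) (Ici 0) t| ≤ C * exp (-t) := by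
  induction p generalizing i with
  | zero =>
    obtain ⟨C, -, hC⟩ := cascade_abs_le_mul_exp_neg ha hu hN i
    exact ⟨C, by simpa using hC⟩
  | succ p ih =>
    obtain ⟨A, hA⟩ := ih i
    obtain ⟨B, hB⟩ := ih (i + 1)
    refine ⟨|a i| * A + B, fun t ht => ?_⟩
    rw [cascade_iteratedDerivWithin_succ hu p i ht]
    refine (abs_add_le _ _).trans ?_
    rw [abs_mul, abs_neg, add_mul, mul_assoc]
    exact add_le_add (mul_le_mul_of_nonneg_left (hA t ht) (abs_nonneg _)) (hB t ht)

end Cascade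

/-- An exponential bound after a time `D` extends to all nonnegative times by compactness. -/
lemma exists_abs_le_mul_exp_neg_of_shift {f : ℝ → ℝ} (hf : ContinuousOn f (Ici 0)) {C D : ℝ}
    (hC : ∀ t ∈ Ici (0 : ℝ), |f (t + D)| ≤ C * exp (-t)) :
    ∃ A, ∀ t ∈ Ici (0 : ℝ), |f t| ≤ A * exp (-t) := by
  obtain ⟨M, hM⟩ := isCompact_Icc.exists_bound_of_continuousOn
    (hf.mono (Icc_subset_Ici_self : Icc 0 D ⊆ Ici 0))
  refine ⟨max M C * exp D, fun t ht => ?_⟩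
  rw [mul_assoc, ← exp_add]
  rcases le_total t D with htD | htD
  · have hMt : |f t| ≤ M := hM t ⟨ht, htD⟩
    have hone : 1 ≤ exp (D + -t) := one_le_exp (by linarith)
    have hmax : |f t| ≤ max M C := hMt.trans (le_max_left _ _)
    nlinarith [abs_nonneg (f t)]
  · have h := hC (t - D) (sub_nonneg.2 htD)
    rw [sub_add_cancel, neg_sub, sub_eq_add_neg] at h
    exact h.trans (mul_le_mul_of_nonneg_right (le_max_right _ _) (exp_pos _).le)

lemma sq_le_sq_mul_exp_of_abs_le {y A t : ℝ} (h : |y| ≤ A * exp (-t)) :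
    y ^ 2 ≤ A ^ 2 * exp (-2 * t) := by
  have hexp : exp (-2 * t) = exp (-t) ^ 2 := by
    rw [← exp_nat_mul]; ring_nf
  rw [hexp, ← mul_pow, ← sq_abs]
  exact pow_le_pow_left₀ (abs_nonneg y) h 2

/-- Lemma 2: for the target system of Lemma 1, the state
`Z = (z_1,…,z_n)` is `C^{m+1}` on `(D,∞)`, the predictor `δ(x,t) = Z(t+Dx)`
satisfies `|Z(t+Dx)|² ≤ C e^{-σt}` uniformly in `x ∈ [0,1]`, and the squared time
derivatives `|(d/dt)^i Z(t+D)|² ≤ C e^{-σt}` for `i = 0,…,m`. Here `σ` depends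
only on `n, m, D` and the gains, while `C` depends additionally on the data. -/
theorem stmt_5 (n m : ℕ) (hn : 1 ≤ n) (hm : 1 ≤ m) (D : ℝ) (hD : 0 < D)
    (k c : ℕ → ℝ)
    (hk : ∀ i, i + 1 < n → 2 < k i) (hkn : 1 < k (n - 1))
    (hc : ∀ j, j + 1 < m → 2 < c j) (hcm : 1 < c (m - 1)) :
    ∃ σ > (0:ℝ),
      ∀ (W : ℝ → ℝ) (z r : ℕ → ℝ → ℝ),
        ContDiffOn ℝ (m : ℕ∞) W (Ici (-D)) →
        (∀ i, i + 1 < n → ∀ t ∈ Ici (0:ℝ),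
          HasDerivWithinAt (z i) (-(k i) * z i t + z (i + 1) t) (Ici 0) t) →
        (∀ t ∈ Ici (0:ℝ),
          HasDerivWithinAt (z (n - 1)) (-(k (n - 1)) * z (n - 1) t + W (t - D)) (Ici 0) t) →
        (∀ j, j + 1 < m → ∀ t ∈ Ici (0:ℝ),
          HasDerivWithinAt (r j) (-(c j) * r j t + r (j + 1) t) (Ici 0) t) →
        (∀ t ∈ Ici (0:ℝ),
          HasDerivWithinAt (r (m - 1)) (-(c (m - 1)) * r (m - 1) t) (Ici 0) t) →
        (∀ t ∈ Ici (0:ℝ), W t = r 0 t) →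
        (∀ i < n, ContDiffOn ℝ ((m : ℕ∞) + 1) (z i) (Ioi D)) ∧
        ∃ C > (0:ℝ), ∀ t ∈ Ici (0:ℝ),
          (∀ x ∈ Icc (0:ℝ) 1,
            (∑ i ∈ range n, (z i (t + D * x)) ^ 2) ≤ C * exp (-σ * t)) ∧
          (∀ j ≤ m,
            (∑ i ∈ range n,
              (iteratedDerivWithin j (fun τ => z i (τ + D)) (Ici 0) t) ^ 2)
              ≤ C * exp (-σ * t)) := by
  refine ⟨2, two_pos, fun W z r _ hz hzn hr hrm hWr => ?_⟩
  obtain ⟨a, ha_def⟩ : ∃ a : ℕ → ℝ,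
      a = fun i => if i < n then k i else if i < n + m then c (i - n) else 2 := ⟨_, rfl⟩
  obtain ⟨u, hu_def⟩ : ∃ u : ℕ → ℝ → ℝ, u = fun i =>
      if i < n then fun τ => z i (τ + D) else if i < n + m then r (i - n) else 0 := ⟨_, rfl⟩
  have huz : ∀ i < n, u i = fun τ => z i (τ + D) := fun i hi => by simp [hu_def, hi]
  have hur : ∀ j < m, u (n + j) = r j := fun j hj => by simp [hu_def, hj]
  have hu0 : ∀ i, n + m ≤ i → u i = 0 := fun i hi => by
    simp [hu_def, show ¬ i < n by omega, show ¬ i < n + m by omega]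
  have haz : ∀ i < n, a i = k i := fun i hi => by simp [ha_def, hi]
  have har : ∀ j < m, a (n + j) = c j := fun j hj => by simp [ha_def, hj]
  have ha2 : ∀ i, n + m ≤ i → a i = 2 := fun i hi => by
    simp [ha_def, show ¬ i < n by omega, show ¬ i < n + m by omega]
  have hcases : ∀ i, i < n ∨ (∃ j < m, i = n + j) ∨ n + m ≤ i := fun i => by
    by_cases h₁ : i < n
    · exact Or.inl h₁
    · by_cases h₂ : i < n + m
      · exact Or.inr (Or.inl ⟨i - n, by omega, by omega⟩)
      · exact Or.inr (Or.inr (by omega))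
  have ha : ∀ i, 1 < a i := by
    intro i
    rcases hcases i with hi | ⟨j, hj, rfl⟩ | hi
    · rw [haz i hi]
      rcases (show i + 1 < n ∨ i = n - 1 by omega) with h | rfl
      · linarith [hk i h]
      · exact hkn
    · rw [har j hj]
      rcases (show j + 1 < m ∨ j = m - 1 by omega) with h | rfl
      · linarith [hc j h]
      · exact hcm
    · rw [ha2 i hi]; norm_num
  have hshift : ∀ (f : ℝ → ℝ) (f' t : ℝ), HasDerivWithinAt f f' (Ici 0) (t + D) →
      HasDerivWithinAt (fun τ => f (τ + D)) f' (Ici 0) t := fun f f' t hf => by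
    have h := hf.scomp t ((hasDerivAt_id t).add_const D).hasDerivWithinAt
      (fun s (hs : s ∈ Ici (0 : ℝ)) => add_nonneg hs hD.le)
    simpa [Function.comp_def] using h
  have hu : ∀ i, ∀ t ∈ Ici (0 : ℝ),
      HasDerivWithinAt (u i) (-a i * u i t + u (i + 1) t) (Ici 0) t := by
    intro i t ht
    have htD : t + D ∈ Ici (0 : ℝ) := add_nonneg ht hD.le
    rcases hcases i with hi | ⟨j, hj, rfl⟩ | hi
    · rw [huz i hi, haz i hi]
      refine hshift (z i) _ t ?_
      rcases (show i + 1 < n ∨ i = n - 1 by omega) with h | rfl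
      · rw [huz (i + 1) h]
        exact hz i h (t + D) htD
      · have hlast : u (n - 1 + 1) = r 0 := by
          rw [← hur 0 hm, add_zero, Nat.sub_add_cancel hn]
        rw [hlast, ← hWr t ht]
        simpa using hzn (t + D) htD
    · rw [hur j hj, har j hj, add_assoc]
      rcases (show j + 1 < m ∨ j = m - 1 by omega) with h | rfl
      · rw [hur (j + 1) h]
        exact hr j h t ht
      · rw [hu0 _ (by omega)]
        simpa using hrm t ht
    · rw [hu0 i hi, hu0 (i + 1) (by omega)]
      exact (hasDerivWithinAt_const t (Ici 0) (0 : ℝ)).congr_deriv (by simp)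
  have hzcont : ∀ i < n, ContinuousOn (z i) (Ici 0) := by
    intro i hi t ht
    rcases (show i + 1 < n ∨ i = n - 1 by omega) with h | rfl
    · exact (hz i h t ht).continuousWithinAt
    · exact (hzn t ht).continuousWithinAt
  refine ⟨fun i hi => ?_, ?_⟩
  · have h := (cascade_contDiffOn hu (m + 1) i).comp
      (contDiff_id.sub contDiff_const).contDiffOn
      (fun s (hs : s ∈ Ioi D) => mem_Ici.2 (sub_nonneg.2 (le_of_lt hs)))
    rw [huz i hi] at h
    simpa [Function.comp_def] using h
  have hzbound : ∀ i, ∃ A, i < n → ∀ t ∈ Ici (0 : ℝ), |z i t| ≤ A * exp (-t) := by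
    intro i
    by_cases hi : i < n
    · obtain ⟨C, -, hC⟩ := cascade_abs_le_mul_exp_neg ha hu hu0 i
      rw [huz i hi] at hC
      obtain ⟨A, hA⟩ := exists_abs_le_mul_exp_neg_of_shift (hzcont i hi) hC
      exact ⟨A, fun _ => hA⟩
    · exact ⟨0, fun h => absurd h hi⟩
  choose A hA using hzbound
  choose B hB using cascade_abs_iteratedDerivWithin_le_mul_exp_neg ha hu hu0
  have hA0 : 0 ≤ ∑ i ∈ range n, A i ^ 2 := Finset.sum_nonneg fun i _ => sq_nonneg _
  have hB0 : ∀ j, 0 ≤ ∑ i ∈ range n, B j i ^ 2 := fun j =>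
    Finset.sum_nonneg fun i _ => sq_nonneg _
  have hBB0 : 0 ≤ ∑ j ∈ range (m + 1), ∑ i ∈ range n, B j i ^ 2 :=
    Finset.sum_nonneg fun j _ => hB0 j
  refine ⟨∑ i ∈ range n, A i ^ 2 + ∑ j ∈ range (m + 1), ∑ i ∈ range n, B j i ^ 2 + 1,
    by positivity, fun t ht => ⟨fun x hx => ?_, fun j hj => ?_⟩⟩
  · have hDx : 0 ≤ D * x := mul_nonneg hD.le hx.1
    calc ∑ i ∈ range n, z i (t + D * x) ^ 2
        ≤ ∑ i ∈ range n, A i ^ 2 * exp (-2 * t) := by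
          refine Finset.sum_le_sum fun i hi => ?_
          refine (sq_le_sq_mul_exp_of_abs_le
            (hA i (Finset.mem_range.1 hi) _ (add_nonneg ht hDx))).trans ?_
          exact mul_le_mul_of_nonneg_left (exp_le_exp.2 (by linarith)) (sq_nonneg _)
      _ = (∑ i ∈ range n, A i ^ 2) * exp (-2 * t) := (Finset.sum_mul ..).symm
      _ ≤ _ := mul_le_mul_of_nonneg_right (by linarith) (exp_pos _).le
  · have hle : ∑ i ∈ range n, B j i ^ 2 ≤ ∑ j ∈ range (m + 1), ∑ i ∈ range n, B j i ^ 2 :=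
      Finset.single_le_sum (f := fun j => ∑ i ∈ range n, B j i ^ 2) (fun j _ => hB0 j)
        (Finset.mem_range.2 (Nat.lt_succ_of_le hj))
    calc ∑ i ∈ range n, iteratedDerivWithin j (fun τ => z i (τ + D)) (Ici 0) t ^ 2
        ≤ ∑ i ∈ range n, B j i ^ 2 * exp (-2 * t) := by
          refine Finset.sum_le_sum fun i hi => ?_
          rw [← huz i (Finset.mem_range.1 hi)]
          exact sq_le_sq_mul_exp_of_abs_le (hB j i t ht)
      _ = (∑ i ∈ range n, B j i ^ 2) * exp (-2 * t) := (Finset.sum_mul ..).symm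
      _ ≤ _ := mul_le_mul_of_nonneg_right (by linarith) (exp_pos _).le
end

section
/- Let n, m ≥ 1 and let k_1,…,k_n be real constants. For i = 1,…,n, let ψ_i : ℝⁱ → ℝ be (n+m-i) times continuously differentiable with ψ_i(0) = 0. Define the gain functions h_0 := 0 and, recursively for i = 1,…,n-1, h_i(y_1,…,y_i, s_0,…,s_{i-1}) := -k_i (y_i − h_{i-1}(y_1,…,y_{i-1}, s_0,…,s_{i-2}) − s_{i-1}) − ψ_i(y_1,…,y_i) + Σ_{k=1}^{i-1} [ (∂h_{i-1}/∂y_k)·(y_{k+1} + ψ_k(y_1,…,y_k)) + (∂h_{i-1}/∂s_{k-1})·s_k ]. For each parameter vector s = (s_0,…,s_{n-1}) ∈ ℝⁿ define Φ_s : ℝⁿ → ℝⁿ by (Φ_s(y))_i := y_i − h_{i-1}(y_1,…,y_{i-1}, s_0,…,s_{i-2}) − s_{i-1}. Then: (a) for every s ∈ ℝⁿ, Φ_s is a bijection of ℝⁿ; (b) there exist continuously differentiable functions h̄_i : ℝⁱ × ℝⁱ → ℝ for i = 0,…,n-1 (with h̄_0 := 0) satisfying h̄_i(0,0) = 0, such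 that the inverse map is given componentwise by y_i = z_i + h̄_{i-1}(z_1,…,z_{i-1}, s_0,…,s_{i-2}) + s_{i-1} where z = Φ_s(y); moreover (c) h̄_{i-1}((Φ_s(y))_1,…,(Φ_s(y))_{i-1}, s_0,…,s_{i-2}) = h_{i-1}(y_1,…,y_{i-1}, s_0,…,s_{i-2}) for all y, s and all i. -/
open Set Finset

/-- Extension of a finite vector to a sequence, by zero. -/
noncomputable def extendFin (n : ℕ) (y : Fin n → ℝ) : ℕ → ℝ :=
  fun j => if h : j < n then y ⟨j, h⟩ else 0

/-- The recursively defined backstepping gain functions `h_i` (0-based data: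
`k i` is the paper's `k_{i+1}`, `ψ i` is the paper's `ψ_{i+1}` and depends on the
first `i+1` coordinates of its argument; `hgain k ψ i` is the paper's `h_i`,
depending on `y_1,…,y_i` (coordinates `0,…,i-1`) and `s_0,…,s_{i-1}`). -/
noncomputable def hgain (k : ℕ → ℝ) (ψ : ℕ → (ℕ → ℝ) → ℝ) :
    ℕ → (ℕ → ℝ) → (ℕ → ℝ) → ℝ
  | 0 => fun _ _ => 0
  | (i + 1) => fun y s =>
      -(k i) * (y i - hgain k ψ i y s - s i) - ψ i y
        + ∑ j ∈ Finset.range i,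
            (deriv (fun a => hgain k ψ i (Function.update y j a) s) (y j)
                * (y (j + 1) + ψ j y)
              + deriv (fun a => hgain k ψ i y (Function.update s j a)) (s j)
                * s (j + 1))

/-- On coordinates below its length, `extendFin` reads off the vector. -/
theorem extendFin_of_lt {n j : ℕ} (y : Fin n → ℝ) (h : j < n) :
    extendFin n y j = y ⟨j, h⟩ := dif_pos h

theorem update_extendFin {n : ℕ} (y : Fin n → ℝ) (j : Fin n) (a : ℝ) :
    Function.update (extendFin n y) j a = extendFin n (Function.update y j a) := by
  funext l
  by_cases hl : l < n
  · by_cases hlj : l = j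
    · subst hlj
      simp [extendFin]
    · have : (⟨l, hl⟩ : Fin n) ≠ j := fun h => hlj (congrArg Fin.val h)
      simp [extendFin, hl, hlj, this]
  · have : l ≠ j := fun h => hl (h ▸ j.2)
    simp [extendFin, hl, this]

theorem ContDiff.extendFin_apply {E : Type*} [NormedAddCommGroup E] [NormedSpace ℝ E]
    {r : WithTop ℕ∞} {n : ℕ} {f : E → Fin n → ℝ} (hf : ContDiff ℝ r f) (j : ℕ) :
    ContDiff ℝ r (fun e => extendFin n (f e) j) := by
  by_cases hj : j < n
  · simpa only [extendFin_of_lt _ hj] using contDiff_pi.1 hf ⟨j, hj⟩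
  · simpa only [extendFin, dif_neg hj] using contDiff_const

section Gain

variable {n m : ℕ} {k : ℕ → ℝ} {ψ : ℕ → (ℕ → ℝ) → ℝ}

/-- The gain `h_i` depends only on the first `i` coordinates of its arguments. -/
theorem hgain_congr
    (hψdep : ∀ i < n, ∀ y y' : ℕ → ℝ, (∀ j ≤ i, y j = y' j) → ψ i y = ψ i y')
    {i : ℕ} (hi : i ≤ n) {y y' s s' : ℕ → ℝ}
    (hy : ∀ j < i, y j = y' j) (hs : ∀ j < i, s j = s' j) :
    hgain k ψ i y s = hgain k ψ i y' s' := by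
  induction i generalizing y y' s s' with
  | zero => rfl
  | succ i ih =>
    have hupd : ∀ {u v : ℕ → ℝ}, (∀ j < i + 1, u j = v j) → ∀ (j : ℕ) (a : ℝ),
        ∀ l < i, Function.update u j a l = Function.update v j a l := by
      intro u v huv j a l hl
      by_cases h : l = j
      · simp [h]
      · simp [h, huv l (by omega)]
    have hy' : ∀ j < i, y j = y' j := fun j hj => hy j (by omega)
    have hs' : ∀ j < i, s j = s' j := fun j hj => hs j (by omega)
    simp only [hgain]
    rw [ih (by omega) hy' hs', hψdep i (by omega) y y' fun j hj => hy j (by omega),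
      hy i (by omega), hs i (by omega)]
    congr 1
    refine Finset.sum_congr rfl fun j hj => ?_
    have hj : j < i := Finset.mem_range.1 hj
    have h₁ : (fun a => hgain k ψ i (Function.update y j a) s) =
        fun a => hgain k ψ i (Function.update y' j a) s' :=
      funext fun a => ih (by omega) (hupd hy j a) hs'
    have h₂ : (fun a => hgain k ψ i y (Function.update s j a)) =
        fun a => hgain k ψ i y' (Function.update s' j a) :=
      funext fun a => ih (by omega) hy' (hupd hs j a)
    rw [h₁, h₂, hy j (by omega), hs j (by omega), hy (j + 1) (by omega), hs (j + 1) (by omega),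
      hψdep j (by omega) y y' fun l hl => hy l (by omega)]

theorem hgain_zero (hψ0 : ∀ i < n, ψ i 0 = 0) {i : ℕ} (hi : i ≤ n) :
    hgain k ψ i 0 0 = 0 := by
  induction i with
  | zero => rfl
  | succ i ih =>
    simp only [hgain]
    rw [ih (by omega), hψ0 i (by omega), Finset.sum_eq_zero]
    · simp
    · intro j hj
      rw [hψ0 j (by have := Finset.mem_range.1 hj; omega)]
      simp

/-- A nonlinearity composed with a sequence of smooth functions is smooth. -/
theorem contDiff_nonlinearity_comp
    (hψdep : ∀ i < n, ∀ y y' : ℕ → ℝ, (∀ j ≤ i, y j = y' j) → ψ i y = ψ i y')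
    (hψsmooth : ∀ i < n, ContDiff ℝ ((n + m - i - 1 : ℕ) : ℕ∞)
      (fun y : Fin (i + 1) → ℝ => ψ i (extendFin (i + 1) y)))
    {E : Type*} [NormedAddCommGroup E] [NormedSpace ℝ E] {i r : ℕ} (hi : i < n)
    (hr : r + i + 1 ≤ n + m) {f : E → ℕ → ℝ} (hf : ∀ j, ContDiff ℝ r (fun e => f e j)) :
    ContDiff ℝ r (fun e => ψ i (f e)) := by
  have hle : (r : WithTop ℕ∞) ≤ (((n + m - i - 1 : ℕ) : ℕ∞) : WithTop ℕ∞) := by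
    have : r ≤ n + m - i - 1 := by omega
    exact_mod_cast this
  have h := ((hψsmooth i hi).of_le hle).comp
    (contDiff_pi.2 fun j : Fin (i + 1) => hf j)
  convert h using 1
  refine funext fun e => hψdep i hi _ _ fun j hj => ?_
  rw [extendFin_of_lt _ (by omega : j < i + 1)]

/-- The gain `h_i` is `n + m - i` times continuously differentiable. -/
theorem contDiff_hgain_extendFin
    (hψdep : ∀ i < n, ∀ y y' : ℕ → ℝ, (∀ j ≤ i, y j = y' j) → ψ i y = ψ i y')
    (hψsmooth : ∀ i < n, ContDiff ℝ ((n + m - i - 1 : ℕ) : ℕ∞)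
      (fun y : Fin (i + 1) → ℝ => ψ i (extendFin (i + 1) y)))
    {i r : ℕ} (hi : i ≤ n) (hr : r + i ≤ n + m) :
    ContDiff ℝ r (fun p : (Fin n → ℝ) × (Fin n → ℝ) =>
      hgain k ψ i (extendFin n p.1) (extendFin n p.2)) := by
  induction i generalizing r with
  | zero => exact contDiff_const
  | succ i ih =>
    set F : (Fin n → ℝ) × (Fin n → ℝ) → ℝ :=
      fun p => hgain k ψ i (extendFin n p.1) (extendFin n p.2) with hF
    have hFr : ContDiff ℝ (r + 1 : ℕ) F := ih (by omega) (by omega)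
    have hFd : Differentiable ℝ F := hFr.differentiable (by simp)
    have hFder : ∀ v, ContDiff ℝ r (fun p => fderiv ℝ F p v) := fun v =>
      (hFr.fderiv_right (by simp)).clm_apply contDiff_const
    have hy : ∀ j, ContDiff ℝ r
        (fun p : (Fin n → ℝ) × (Fin n → ℝ) => extendFin n p.1 j) :=
      contDiff_fst.extendFin_apply
    have hs : ∀ j, ContDiff ℝ r
        (fun p : (Fin n → ℝ) × (Fin n → ℝ) => extendFin n p.2 j) :=
      contDiff_snd.extendFin_apply
    simp only [hgain]
    refine ((contDiff_const.mul (((hy i).sub (hFr.of_le (by simp))).sub (hs i))).sub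
      (contDiff_nonlinearity_comp hψdep hψsmooth (by omega) (by omega) hy)).add
      (ContDiff.sum fun j hj => ?_)
    have hj : j < i := Finset.mem_range.1 hj
    have hjn : j < n := by omega
    refine ContDiff.add (ContDiff.mul ?_ ((hy (j + 1)).add
      (contDiff_nonlinearity_comp hψdep hψsmooth hjn (by omega) hy)))
      (ContDiff.mul ?_ (hs (j + 1)))
    · refine (congrArg (ContDiff ℝ r) (funext fun p => ?_)).mpr (hFder (Pi.single ⟨j, hjn⟩ 1, 0))
      have h : HasDerivAt (fun a => F (Function.update p.1 ⟨j, hjn⟩ a, p.2))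
          (fderiv ℝ F p (Pi.single ⟨j, hjn⟩ 1, 0)) (p.1 ⟨j, hjn⟩) := by
        refine HasFDerivAt.comp_hasDerivAt (l := F) (l' := fderiv ℝ F p) (p.1 ⟨j, hjn⟩) ?_
          ((hasDerivAt_update p.1 ⟨j, hjn⟩ _).prodMk (hasDerivAt_const _ p.2))
        rw [Function.update_eq_self]
        exact (hFd p).hasFDerivAt
      rw [extendFin_of_lt _ hjn, ← h.deriv]
      simp only [hF, ← update_extendFin]
    · refine (congrArg (ContDiff ℝ r) (funext fun p => ?_)).mpr (hFder (0, Pi.single ⟨j, hjn⟩ 1))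
      have h : HasDerivAt (fun a => F (p.1, Function.update p.2 ⟨j, hjn⟩ a))
          (fderiv ℝ F p (0, Pi.single ⟨j, hjn⟩ 1)) (p.2 ⟨j, hjn⟩) := by
        refine HasFDerivAt.comp_hasDerivAt (l := F) (l' := fderiv ℝ F p) (p.2 ⟨j, hjn⟩) ?_
          ((hasDerivAt_const _ p.1).prodMk (hasDerivAt_update p.2 ⟨j, hjn⟩ _))
        rw [Function.update_eq_self]
        exact (hFd p).hasFDerivAt
      rw [extendFin_of_lt _ hjn, ← h.deriv]
      simp only [hF, ← update_extendFin]

theorem contDiff_hgain_comp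
    (hψdep : ∀ i < n, ∀ y y' : ℕ → ℝ, (∀ j ≤ i, y j = y' j) → ψ i y = ψ i y')
    (hψsmooth : ∀ i < n, ContDiff ℝ ((n + m - i - 1 : ℕ) : ℕ∞)
      (fun y : Fin (i + 1) → ℝ => ψ i (extendFin (i + 1) y)))
    {E : Type*} [NormedAddCommGroup E] [NormedSpace ℝ E] {i r : ℕ} (hi : i ≤ n)
    (hr : r + i ≤ n + m) {f g : E → ℕ → ℝ} (hf : ∀ j, ContDiff ℝ r (fun e => f e j))
    (hg : ∀ j, ContDiff ℝ r (fun e => g e j)) :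
    ContDiff ℝ r (fun e => hgain k ψ i (f e) (g e)) := by
  have h := (contDiff_hgain_extendFin (k := k) hψdep hψsmooth hi hr).comp
    ((contDiff_pi.2 fun j : Fin n => hf j).prodMk (contDiff_pi.2 fun j : Fin n => hg j))
  convert h using 1
  refine funext fun e => hgain_congr hψdep hi (fun j hj => ?_) fun j hj => ?_ <;>
    simp only [extendFin_of_lt _ (by omega : j < n)]

/-- The first `i` coordinates of the solution `y` of `z_j = y_j - h_j(y, s) - s_j`,
extended by zero. -/
noncomputable def backsteppingInv (k : ℕ → ℝ) (ψ : ℕ → (ℕ → ℝ) → ℝ) (z s : ℕ → ℝ) :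
    ℕ → ℕ → ℝ
  | 0 => 0
  | i + 1 => Function.update (backsteppingInv k ψ z s i) i
      (z i + hgain k ψ i (backsteppingInv k ψ z s i) s + s i)

theorem backsteppingInv_congr
    (hψdep : ∀ i < n, ∀ y y' : ℕ → ℝ, (∀ j ≤ i, y j = y' j) → ψ i y = ψ i y')
    {i : ℕ} (hi : i ≤ n) {z z' s s' : ℕ → ℝ}
    (hz : ∀ j < i, z j = z' j) (hs : ∀ j < i, s j = s' j) :
    backsteppingInv k ψ z s i = backsteppingInv k ψ z' s' i := by
  induction i with
  | zero => rfl
  | succ i ih =>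
    have hs' : ∀ j < i, s j = s' j := fun j hj => hs j (by omega)
    simp only [backsteppingInv]
    rw [ih (by omega) (fun j hj => hz j (by omega)) hs', hz i (by omega), hs i (by omega),
      hgain_congr hψdep (by omega) (fun _ _ => rfl) hs']

theorem backsteppingInv_zero (hψ0 : ∀ i < n, ψ i 0 = 0) {i : ℕ} (hi : i ≤ n) :
    backsteppingInv k ψ 0 0 i = 0 := by
  induction i with
  | zero => rfl
  | succ i ih =>
    simp [backsteppingInv, ih (by omega), hgain_zero hψ0 (by omega : i ≤ n)]

theorem contDiff_backsteppingInv_comp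
    (hψdep : ∀ i < n, ∀ y y' : ℕ → ℝ, (∀ j ≤ i, y j = y' j) → ψ i y = ψ i y')
    (hψsmooth : ∀ i < n, ContDiff ℝ ((n + m - i - 1 : ℕ) : ℕ∞)
      (fun y : Fin (i + 1) → ℝ => ψ i (extendFin (i + 1) y)))
    {E : Type*} [NormedAddCommGroup E] [NormedSpace ℝ E] {i r : ℕ} (hi : i ≤ n)
    (hr : r + i ≤ n + m) {f g : E → ℕ → ℝ} (hf : ∀ j, ContDiff ℝ r (fun e => f e j))
    (hg : ∀ j, ContDiff ℝ r (fun e => g e j)) (j : ℕ) :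
    ContDiff ℝ r (fun e => backsteppingInv k ψ (f e) (g e) i j) := by
  induction i generalizing j with
  | zero => exact contDiff_const
  | succ i ih =>
    have ih := ih (by omega) (by omega)
    by_cases h : j = i
    · subst h
      simpa only [backsteppingInv, Function.update_self] using
        ((hf j).add (contDiff_hgain_comp hψdep hψsmooth (by omega) (by omega) ih hg)).add (hg j)
    · simpa only [backsteppingInv, Function.update_of_ne h] using ih j

/-- `backsteppingInv` is a left inverse of the backstepping transformation. -/
theorem backsteppingInv_apply_of_eq
    (hψdep : ∀ i < n, ∀ y y' : ℕ → ℝ, (∀ j ≤ i, y j = y' j) → ψ i y = ψ i y')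
    {i : ℕ} (hi : i ≤ n) {y z s : ℕ → ℝ}
    (hz : ∀ j < i, z j = y j - hgain k ψ j y s - s j) {j : ℕ} (hj : j < i) :
    backsteppingInv k ψ z s i j = y j := by
  induction i generalizing j with
  | zero => omega
  | succ i ih =>
    have ih' : ∀ l < i, backsteppingInv k ψ z s i l = y l := fun l hl =>
      ih (by omega) (fun j hj => hz j (by omega)) hl
    by_cases h : j = i
    · subst h
      simp only [backsteppingInv, Function.update_self]
      rw [hgain_congr hψdep (by omega) ih' (fun _ _ => rfl), hz j hj]
      ring
    · simp only [backsteppingInv, Function.update_of_ne h]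
      exact ih' j (by omega)

/-- `backsteppingInv` is a right inverse of the backstepping transformation. -/
theorem backsteppingInv_apply
    (hψdep : ∀ i < n, ∀ y y' : ℕ → ℝ, (∀ j ≤ i, y j = y' j) → ψ i y = ψ i y')
    {i : ℕ} (hi : i ≤ n) (z s : ℕ → ℝ) {j : ℕ} (hj : j < i) :
    backsteppingInv k ψ z s i j = z j + hgain k ψ j (backsteppingInv k ψ z s i) s + s j := by
  induction i generalizing j with
  | zero => omega
  | succ i ih =>
    have hgain_eq : hgain k ψ j (backsteppingInv k ψ z s (i + 1)) s =
        hgain k ψ j (backsteppingInv k ψ z s i) s :=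
      hgain_congr hψdep (by omega)
        (fun l hl => Function.update_of_ne (by omega) _ _) fun _ _ => rfl
    rw [hgain_eq]
    by_cases h : j = i
    · subst h
      simp only [backsteppingInv, Function.update_self]
    · simp only [backsteppingInv, Function.update_of_ne h]
      exact ih (by omega) (by omega)

end Gain

/-- Proposition 1, `Y`-part: the nonovershooting backstepping
transformation `(Φ_s(y))_i = y_i - h_{i-1}(y,s) - s_{i-1}` is a bijection of `ℝⁿ`
for every parameter vector `s`, and its inverse has the analogous triangular form
built from continuously differentiable functions `h̄_i` vanishing at the origin,
with `h̄_{i-1}(Φ_s(y), s) = h_{i-1}(y, s)`. -/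
theorem stmt_7 (n m : ℕ) (hn : 1 ≤ n) (hm : 1 ≤ m) (k : ℕ → ℝ)
    (ψ : ℕ → (ℕ → ℝ) → ℝ)
    (hψdep : ∀ i < n, ∀ y y' : ℕ → ℝ, (∀ j ≤ i, y j = y' j) → ψ i y = ψ i y')
    (hψsmooth : ∀ i < n, ContDiff ℝ ((n + m - i - 1 : ℕ) : ℕ∞)
      (fun y : Fin (i + 1) → ℝ => ψ i (extendFin (i + 1) y)))
    (hψ0 : ∀ i < n, ψ i 0 = 0) :
    (∀ s : Fin n → ℝ, Function.Bijective
        (fun y : Fin n → ℝ => fun i : Fin n =>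
          y i - hgain k ψ i (extendFin n y) (extendFin n s) - s i)) ∧
    ∃ hbar : ℕ → (ℕ → ℝ) → (ℕ → ℝ) → ℝ,
      (∀ y s, hbar 0 y s = 0) ∧
      (∀ i < n,
        (∀ z z' s s' : ℕ → ℝ, (∀ j < i, z j = z' j) → (∀ j < i, s j = s' j) →
            hbar i z s = hbar i z' s') ∧
        ContDiff ℝ 1 (fun p : (Fin i → ℝ) × (Fin i → ℝ) =>
          hbar i (extendFin i p.1) (extendFin i p.2)) ∧
        hbar i 0 0 = 0) ∧
      (∀ s y : Fin n → ℝ, ∀ i : Fin n,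
        y i = (y i - hgain k ψ i (extendFin n y) (extendFin n s) - s i)
          + hbar i (extendFin n (fun j : Fin n =>
              y j - hgain k ψ j (extendFin n y) (extendFin n s) - s j)) (extendFin n s)
          + s i) ∧
      (∀ s y : Fin n → ℝ, ∀ i < n,
        hbar i (extendFin n (fun j : Fin n =>
            y j - hgain k ψ j (extendFin n y) (extendFin n s) - s j)) (extendFin n s)
          = hgain k ψ i (extendFin n y) (extendFin n s)) := by
  have hΦ : ∀ (s y : Fin n → ℝ) (i : ℕ), i ≤ n → ∀ j < i,
      backsteppingInv k ψ (extendFin n (fun j : Fin n =>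
        y j - hgain k ψ j (extendFin n y) (extendFin n s) - s j)) (extendFin n s) i j =
        extendFin n y j := by
    intro s y i hi j hj
    refine backsteppingInv_apply_of_eq hψdep hi (fun l hl => ?_) hj
    simp only [extendFin_of_lt _ (by omega : l < n)]
  have hbar_eq : ∀ s y : Fin n → ℝ, ∀ i < n,
      hgain k ψ i (backsteppingInv k ψ (extendFin n (fun j : Fin n =>
        y j - hgain k ψ j (extendFin n y) (extendFin n s) - s j)) (extendFin n s) i)
        (extendFin n s) = hgain k ψ i (extendFin n y) (extendFin n s) := fun s y i hi =>
    hgain_congr hψdep hi.le (hΦ s y i hi.le) fun _ _ => rfl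
  refine ⟨fun s => ⟨fun y y' hyy' => ?_, fun z => ?_⟩,
    fun i z s => hgain k ψ i (backsteppingInv k ψ z s i) s, fun _ _ => rfl,
    fun i hi => ⟨fun z z' s s' hz hs => ?_, ?_, ?_⟩, fun s y i => ?_, hbar_eq⟩
  · funext i
    have h := hΦ s y n le_rfl i i.2
    have h' := hΦ s y' n le_rfl i i.2
    beta_reduce at hyy'
    rw [hyy', h'] at h
    simpa only [extendFin_of_lt _ i.2] using h.symm
  · set Y := backsteppingInv k ψ (extendFin n z) (extendFin n s) n
    refine ⟨fun i => Y i, funext fun i => ?_⟩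
    have h : Y i = _ :=
      backsteppingInv_apply (k := k) hψdep le_rfl (extendFin n z) (extendFin n s) i.2
    have hY : hgain k ψ i (extendFin n fun i => Y i) (extendFin n s) =
        hgain k ψ i Y (extendFin n s) :=
      hgain_congr hψdep i.2.le (fun j hj => extendFin_of_lt _ (hj.trans i.2)) fun _ _ => rfl
    simp only [extendFin_of_lt _ i.2] at h
    beta_reduce
    rw [hY, h]
    ring
  · beta_reduce
    rw [backsteppingInv_congr hψdep hi.le hz hs]
    exact hgain_congr hψdep hi.le (fun _ _ => rfl) hs
  · have hz : ∀ j, ContDiff ℝ (1 : ℕ)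
        (fun p : (Fin i → ℝ) × (Fin i → ℝ) => extendFin i p.1 j) :=
      contDiff_fst.extendFin_apply
    have hs : ∀ j, ContDiff ℝ (1 : ℕ)
        (fun p : (Fin i → ℝ) × (Fin i → ℝ) => extendFin i p.2 j) :=
      contDiff_snd.extendFin_apply
    exact_mod_cast contDiff_hgain_comp (k := k) hψdep hψsmooth hi.le (by omega)
      (contDiff_backsteppingInv_comp (k := k) hψdep hψsmooth hi.le (by omega) hz hs) hs
  · beta_reduce
    rw [backsteppingInv_zero hψ0 hi.le, hgain_zero hψ0 hi.le]
  · beta_reduce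
    rw [hbar_eq s y i i.2]
    ring
end
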